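/- arXiv:1205.0693 — 4 statements merged into one kernel-verified Lean document; each statement's English description precedes it below -/
import Mathlib

section
/- Let n ≥ 2 and let A be an n×n complex matrix such that 1 is an eigenvalue of A. Suppose P is an idempotent matrix of rank one (P² = P, rank P = 1) and k ≥ 1 is such that A^k = P while A^r ≠ P for all 1 ≤ r < k. Then k ≤ n − 1. -/
open Module in
/-- If a power `f ^ k` is a rank-one idempotent and `f` fixes a nonzero vector, then `f ^ m` is the
same idempotent, where `m + 1` is the dimension of the space. -/
theorem Module.End.pow_eq_pow_of_isIdempotentElem_of_finrank_range_eq_one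
    {K V : Type*} [Field K] [AddCommGroup V] [Module K V] [FiniteDimensional K V]
    {f : End K V} {k m : ℕ} (hidem : IsIdempotentElem (f ^ k))
    (hrank : finrank K (LinearMap.range (f ^ k)) = 1)
    {v : V} (hv : v ≠ 0) (hfv : f v = v) (hm : finrank K V = m + 1) :
    f ^ m = f ^ k := by
  have hfix (j : ℕ) : (f ^ j) v = v := by
    rw [Module.End.pow_apply]
    exact Function.iterate_fixed hfv j
  have hfp (x : V) : (f ^ m) ((f ^ k) x) = (f ^ k) x := by
    obtain ⟨c, hc⟩ := exists_smul_eq_of_finrank_eq_one hrank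
      (x := ⟨v, v, hfix k⟩) (fun h => hv (congrArg Subtype.val h)) ⟨(f ^ k) x, x, rfl⟩
    have hc : c • v = (f ^ k) x := congrArg Subtype.val hc
    rw [← hc, map_smul, hfix]
  have hker : finrank K (LinearMap.ker (f ^ k)) = m := by
    have := LinearMap.finrank_range_add_finrank_ker (f ^ k)
    omega
  have hmaps : ∀ x ∈ LinearMap.ker (f ^ k), f x ∈ LinearMap.ker (f ^ k) := by
    intro x hx
    rw [LinearMap.mem_ker] at hx ⊢
    rw [← Module.End.mul_apply, ← pow_succ, pow_succ', Module.End.mul_apply, hx, map_zero]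
  have hnil : ∀ x ∈ LinearMap.ker (f ^ k), (f ^ m) x = 0 := by
    intro x hx
    have hle := Module.End.ker_pow_le_ker_pow_finrank (f.restrict hmaps) k
    rw [hker, Module.End.pow_restrict k, Module.End.pow_restrict m] at hle
    exact congrArg Subtype.val (LinearMap.mem_ker.mp (hle (x := ⟨x, hx⟩) (Subtype.ext hx)))
  ext x
  have hx : x - (f ^ k) x ∈ LinearMap.ker (f ^ k) := by
    rw [LinearMap.mem_ker, map_sub, ← Module.End.mul_apply, hidem.eq, sub_self]
  have := hnil _ hx
  rwa [map_sub, hfp, sub_eq_zero] at this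

/-- If an `n × n` complex matrix `A` (with `n ≥ 2`) has `1` as an eigenvalue, and some power
`A ^ k` (with `k` minimal, `k ≥ 1`) equals a rank-one idempotent `P`, then `k ≤ n - 1`. -/
theorem root_order_le_of_rank_one_idempotent (n : ℕ) (hn : 2 ≤ n)
    (A : Matrix (Fin n) (Fin n) ℂ)
    (heig : ∃ v : Fin n → ℂ, v ≠ 0 ∧ A.mulVec v = v)
    (P : Matrix (Fin n) (Fin n) ℂ) (hP : P * P = P) (hrank : P.rank = 1)
    (k : ℕ) (hk : 1 ≤ k) (hAk : A ^ k = P)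
    (hmin : ∀ r, 1 ≤ r → r < k → A ^ r ≠ P) :
    k ≤ n - 1 := by
  obtain ⟨v, hv, hAv⟩ := heig
  by_contra! hlt
  refine hmin (n - 1) (by omega) hlt ?_
  have hpow : Matrix.toLin' A ^ k = Matrix.toLin' P := by rw [← Matrix.toLin'_pow, hAk]
  apply Matrix.toLin'.injective
  rw [Matrix.toLin'_pow, ← hpow]
  refine Module.End.pow_eq_pow_of_isIdempotentElem_of_finrank_range_eq_one ?_ ?_ hv
    (by rwa [Matrix.toLin'_apply]) (by rw [Module.finrank_fin_fun]; omega)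
  · rw [hpow, IsIdempotentElem, Module.End.mul_eq_comp, ← Matrix.toLin'_mul, hP]
  · rwa [hpow]
end

section
/- Let d ≥ 2, let {A₁ = 𝟙, A₂, ..., A_{d²}} be a basis of M_d(ℂ) of Hermitian matrices with tr(A_i) = 0 for i ≥ 2, and {A^i} its Hilbert–Schmidt dual basis (so A^1 = 𝟙/d). For ε ∈ ℝ define T_ε(X) = (1/d)·𝟙·tr(X) + ε·Σ_{i=2}^{d²−1} A_i·tr((A^{i+1})* X). Then for every ε ≠ 0: T_ε^{d²−1}(X) = tr(X)·𝟙/d for all X ∈ M_d(ℂ), while T_ε^{d²−2} ≠ T_{𝟙/d}; indeed T_ε(A₁) = 𝟙, T_ε(A₂) = 0, and T_ε(A_j) = ε·A_{j−1} for 3 ≤ j ≤ d², so the nilpotent part of T_ε is a single Jordan chain of length d² − 1. -/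
open scoped Matrix

/-- The bistochastic completely depolarizing channel `X ↦ tr(X) • 𝟙/d`. -/
noncomputable def depol (d : ℕ) : Matrix (Fin d) (Fin d) ℂ →ₗ[ℂ] Matrix (Fin d) (Fin d) ℂ :=
  (Matrix.traceLinearMap (Fin d) ℂ ℂ).smulRight ((d : ℂ)⁻¹ • 1)

/-- The perturbed map `T_ε(X) = (1/d) 𝟙 tr X + ε ∑_{i=2}^{d²-1} A_i tr((A^{i+1})* X)`
(indices in the sum are `1`-based as in the paper; here `0`-based `j` runs over
`1 ≤ j`, `j + 1 < d²`). -/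
noncomputable def Teps (d : ℕ) (A A' : Fin (d ^ 2) → Matrix (Fin d) (Fin d) ℂ) (ε : ℝ) :
    Matrix (Fin d) (Fin d) ℂ →ₗ[ℂ] Matrix (Fin d) (Fin d) ℂ :=
  (Matrix.traceLinearMap (Fin d) ℂ ℂ).smulRight ((d : ℂ)⁻¹ • 1) +
  (ε : ℂ) • ∑ j : Fin (d ^ 2),
    if h : 1 ≤ (j : ℕ) ∧ (j : ℕ) + 1 < d ^ 2 then
      ((Matrix.traceLinearMap (Fin d) ℂ ℂ).comp
        (LinearMap.mulLeft ℂ ((A' ⟨(j : ℕ) + 1, h.2⟩)ᴴ))).smulRight (A j)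
    else 0

section Chain

variable {d : ℕ} {A A' : Fin (d ^ 2) → Matrix (Fin d) (Fin d) ℂ} {ε : ℝ}

/-- On a basis vector, the shift part of `Teps` is read off from the duality relations. -/
theorem Teps_apply_basis
    (hdual : ∀ i j, ((A' j)ᴴ * A i).trace = if i = j then 1 else 0) (i : Fin (d ^ 2)) :
    Teps d A A' ε (A i) = (A i).trace • ((d : ℂ)⁻¹ • 1) +
      (ε : ℂ) • ∑ j : Fin (d ^ 2),
        if 1 ≤ (j : ℕ) ∧ (i : ℕ) = (j : ℕ) + 1 then A j else 0 := by
  simp only [Teps, LinearMap.add_apply, LinearMap.smulRight_apply, LinearMap.smul_apply,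
    LinearMap.sum_apply, Matrix.traceLinearMap_apply]
  congr 2
  refine Finset.sum_congr rfl fun j _ => ?_
  by_cases h : 1 ≤ (j : ℕ) ∧ (j : ℕ) + 1 < d ^ 2
  · simp [h, hdual, Fin.ext_iff]
  · rw [dif_neg h, if_neg (by omega), LinearMap.zero_apply]

theorem Teps_apply_of_le_one
    (hdual : ∀ i j, ((A' j)ᴴ * A i).trace = if i = j then 1 else 0)
    {i : Fin (d ^ 2)} (hi : (i : ℕ) ≤ 1) :
    Teps d A A' ε (A i) = (A i).trace • ((d : ℂ)⁻¹ • 1) := by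
  rw [Teps_apply_basis hdual, Finset.sum_eq_zero, smul_zero, add_zero]
  intro j _
  exact if_neg (by omega)

theorem Teps_apply_succ
    (hdual : ∀ i j, ((A' j)ᴴ * A i).trace = if i = j then 1 else 0)
    {n : ℕ} (hn : 1 ≤ n) (h : n + 1 < d ^ 2) (htr : (A ⟨n + 1, h⟩).trace = 0) :
    Teps d A A' ε (A ⟨n + 1, h⟩) = (ε : ℂ) • A ⟨n, n.lt_succ_self.trans h⟩ := by
  rw [Teps_apply_basis hdual, htr, zero_smul, zero_add,
    Finset.sum_eq_single ⟨n, n.lt_succ_self.trans h⟩]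
  · simp [hn]
  · intro j _ hj
    refine if_neg fun hj' => hj (Fin.ext ?_)
    simpa using hj'.2.symm
  · simp

theorem Teps_pow_apply
    (hdual : ∀ i j, ((A' j)ᴴ * A i).trace = if i = j then 1 else 0)
    (htr : ∀ i : Fin (d ^ 2), (i : ℕ) ≠ 0 → (A i).trace = 0)
    (n : ℕ) (h : n + 1 < d ^ 2) (h1 : 1 < d ^ 2) :
    (Teps d A A' ε ^ n) (A ⟨n + 1, h⟩) = (ε : ℂ) ^ n • A ⟨1, h1⟩ := by
  induction n with
  | zero => simp
  | succ n ih =>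
    rw [pow_succ, Module.End.mul_apply, Teps_apply_succ hdual (by omega) h (htr _ (by simp)),
      map_smul, ih, smul_smul, pow_succ' (ε : ℂ)]

end Chain

/-- For every `ε ≠ 0`, `T_ε^{d²-1}` is the bistochastic completely depolarizing channel while
`T_ε^{d²-2}` is not; indeed `T_ε(A₁) = 𝟙`, `T_ε(A₂) = 0` and `T_ε(A_j) = ε A_{j-1}` for
`3 ≤ j ≤ d²` (1-based indices), so the nilpotent part of `T_ε` is a single Jordan chain of
length `d² - 1`. This is purely algebraic; no complete positivity is needed. -/
theorem Teps_jordan_chain (d : ℕ) [NeZero d] (hd : 2 ≤ d)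
    (A A' : Fin (d ^ 2) → Matrix (Fin d) (Fin d) ℂ)
    (hA0 : A 0 = 1)
    (hherm : ∀ i, (A i).IsHermitian)
    (htr : ∀ i, i ≠ 0 → (A i).trace = 0)
    (hspan : Submodule.span ℂ (Set.range A) = ⊤)
    (hA'0 : A' 0 = (d : ℂ)⁻¹ • 1)
    (hdual : ∀ i j, ((A' j)ᴴ * A i).trace = if i = j then 1 else 0)
    (ε : ℝ) (hε : ε ≠ 0) :
    (∀ X : Matrix (Fin d) (Fin d) ℂ,
        (Teps d A A' ε ^ (d ^ 2 - 1)) X = X.trace • ((d : ℂ)⁻¹ • 1)) ∧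
    Teps d A A' ε ^ (d ^ 2 - 2) ≠ depol d ∧
    Teps d A A' ε (A 0) = 1 ∧
    Teps d A A' ε (A 1) = 0 ∧
    (∀ j : Fin (d ^ 2), 2 ≤ (j : ℕ) →
      Teps d A A' ε (A j) =
        (ε : ℂ) • A ⟨(j : ℕ) - 1, Nat.lt_of_le_of_lt (Nat.sub_le _ _) j.isLt⟩) := by
  have h4 : 2 ^ 2 ≤ d ^ 2 := Nat.pow_le_pow_left hd 2
  have h1 : 1 < d ^ 2 := by omega
  have hone : (1 : Fin (d ^ 2)) = ⟨1, h1⟩ := Fin.ext (by simp [Nat.mod_eq_of_lt h1])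
  have htr' : ∀ i : Fin (d ^ 2), (i : ℕ) ≠ 0 → (A i).trace = 0 :=
    fun i hi => htr i fun h => hi (by simp [h])
  have hd0 : (d : ℂ) ≠ 0 := NeZero.ne _
  have hT0 : Teps d A A' ε (A 0) = 1 := by
    rw [Teps_apply_of_le_one hdual (by simp), hA0, Matrix.trace_one, smul_smul]
    simp [hd0]
  have hT1 : Teps d A A' ε (A ⟨1, h1⟩) = 0 := by
    rw [Teps_apply_of_le_one hdual (by simp), htr' _ (by simp), zero_smul]
  refine ⟨fun X => ?_, fun h => ?_, hT0, hone ▸ hT1, fun j hj => ?_⟩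
  · suffices Teps d A A' ε ^ (d ^ 2 - 1) = depol d by rw [this]; rfl
    refine LinearMap.ext_on_range hspan fun i => ?_
    obtain ⟨_ | n, hn⟩ := i
    · have hfix : ∀ k : ℕ, (Teps d A A' ε ^ k) 1 = 1 := fun k => by
        rw [hA0] at hT0
        induction k with
        | zero => simp
        | succ k ih => rw [pow_succ, Module.End.mul_apply, hT0, ih]
      have hzero : A ⟨0, hn⟩ = 1 := hA0
      rw [hzero, hfix]
      simp [depol, smul_smul, hd0]
    · obtain ⟨k, hk⟩ : ∃ k, d ^ 2 - 1 = k + 1 + n := ⟨d ^ 2 - 1 - (n + 1), by omega⟩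
      rw [hk, pow_add, Module.End.mul_apply, Teps_pow_apply hdual htr' n hn h1, map_smul,
        pow_succ, Module.End.mul_apply, hT1]
      simp [depol, htr' ⟨n + 1, hn⟩]
  · have hlast : d ^ 2 - 2 + 1 < d ^ 2 := by omega
    have hchain := Teps_pow_apply (ε := ε) hdual htr' (d ^ 2 - 2) hlast h1
    have hdepol : depol d (A ⟨d ^ 2 - 2 + 1, hlast⟩) = 0 := by
      simp [depol, htr' ⟨d ^ 2 - 2 + 1, hlast⟩]
    rw [h, hdepol, eq_comm, smul_eq_zero] at hchain
    have hA1 : A ⟨1, h1⟩ = 0 :=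
      hchain.resolve_left (pow_ne_zero _ (Complex.ofReal_ne_zero.mpr hε))
    simpa [hA1] using hdual ⟨1, h1⟩ ⟨1, h1⟩
  · obtain ⟨_ | n, hn⟩ := j
    · simp at hj
    · exact Teps_apply_succ hdual (by simpa using hj) hn (htr' _ (by simp))
end

section
/- Let V : ℂ^d → ℂ^d ⊗ ℂ^r be an isometry (V*V = 𝟙_d), for A ∈ M_r(ℂ) define 𝔼_A : M_d(ℂ) → M_d(ℂ) by 𝔼_A(X) = V*(X ⊗ A)V, and set T = 𝔼_𝟙. Suppose T^k(X) = tr(X)·𝟙/d for all X ∈ M_d(ℂ). Then for all m, p ≥ 0 and all A₁, ..., A_m, B₁, ..., B_p ∈ M_r(ℂ): (1/d)·tr( 𝔼_{A₁}∘⋯∘𝔼_{A_m}∘T^k∘𝔼_{B₁}∘⋯∘𝔼_{B_p}(𝟙) ) = [(1/d)·tr( 𝔼_{A₁}∘⋯∘𝔼_{A_m}(𝟙) )] · [(1/d)·tr( 𝔼_{B₁}∘⋯∘𝔼_{B_p}(𝟙) )]. In other words, the finitely correlated state generated by a k-th root of the bistochastic completely depolarizing channel (with the maximally mixed initial state) is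 k-dependent: expectation values of observables separated by at least k sites factorize. -/
open scoped Matrix Kronecker

/-- For an isometry `V : ℂ^d → ℂ^d ⊗ ℂ^r`, the map `𝔼_A(X) = V* (X ⊗ A) V`. -/
noncomputable def Emap {d r : ℕ} (V : Matrix (Fin d × Fin r) (Fin d) ℂ)
    (A : Matrix (Fin r) (Fin r) ℂ) (X : Matrix (Fin d) (Fin d) ℂ) :
    Matrix (Fin d) (Fin d) ℂ :=
  Vᴴ * (X ⊗ₖ A) * V

/-- The composition `𝔼_{A₁} ∘ ⋯ ∘ 𝔼_{A_m}` applied to `X`, for a list `[A₁, …, A_m]`. -/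
noncomputable def Echain {d r : ℕ} (V : Matrix (Fin d × Fin r) (Fin d) ℂ)
    (l : List (Matrix (Fin r) (Fin r) ℂ)) (X : Matrix (Fin d) (Fin d) ℂ) :
    Matrix (Fin d) (Fin d) ℂ :=
  l.foldr (Emap V) X

theorem Emap_smul {d r : ℕ} (V : Matrix (Fin d × Fin r) (Fin d) ℂ)
    (A : Matrix (Fin r) (Fin r) ℂ) (c : ℂ) (X : Matrix (Fin d) (Fin d) ℂ) :
    Emap V A (c • X) = c • Emap V A X := by
  simp [Emap, Matrix.smul_kronecker]

theorem Echain_smul {d r : ℕ} (V : Matrix (Fin d × Fin r) (Fin d) ℂ)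
    (l : List (Matrix (Fin r) (Fin r) ℂ)) (c : ℂ) (X : Matrix (Fin d) (Fin d) ℂ) :
    Echain V l (c • X) = c • Echain V l X := by
  induction l with
  | nil => rfl
  | cons A l ih =>
    change Emap V A (Echain V l (c • X)) = c • Emap V A (Echain V l X)
    rw [ih, Emap_smul]

/-- If `T = 𝔼_𝟙` satisfies `T^k(X) = tr(X) 𝟙/d`, then the finitely correlated state
`ω(A₁ ⊗ ⋯ ⊗ A_n) = (1/d) tr(𝔼_{A₁} ∘ ⋯ ∘ 𝔼_{A_n}(𝟙))` generated by `(T, 𝟙/d)` is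
`k`-dependent: expectations of observables separated by `k` unobserved sites factorize. -/
theorem root_generates_k_dependent_state (d r k : ℕ)
    (V : Matrix (Fin d × Fin r) (Fin d) ℂ) (hV : Vᴴ * V = 1)
    (hT : ∀ X : Matrix (Fin d) (Fin d) ℂ,
      (Emap V (1 : Matrix (Fin r) (Fin r) ℂ))^[k] X =
        X.trace • ((d : ℂ)⁻¹ • (1 : Matrix (Fin d) (Fin d) ℂ))) :
    ∀ As Bs : List (Matrix (Fin r) (Fin r) ℂ),
      (d : ℂ)⁻¹ *
          (Echain V As ((Emap V (1 : Matrix (Fin r) (Fin r) ℂ))^[k] (Echain V Bs 1))).trace =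
        ((d : ℂ)⁻¹ * (Echain V As 1).trace) * ((d : ℂ)⁻¹ * (Echain V Bs 1).trace) := by
  intro As Bs
  rw [hT, Echain_smul, Echain_smul, Matrix.trace_smul, Matrix.trace_smul, smul_eq_mul,
    smul_eq_mul]
  ring
end

section
/- Let a, b ∈ ℝ and define the 3×3 real matrices X₂ = [[0,0,0],[−a,0,0],[0,a,0]] and X₃ = [[0,b,0],[0,0,b],[0,0,0]]. Then: (i) for all α, β ∈ ℝ, the matrix α·X₂ + β·X₃ is nilpotent, indeed (α·X₂ + β·X₃)³ = 0; (ii) X₃·X₂ = diag(−ab, ab, 0), so if a·b ≠ 0 then (X₃·X₂)^n ≠ 0 for every n ≥ 1. Hence the linear span of X₂ and X₃ consists of nilpotent matrices but the (associative) algebra generated by X₂ and X₃ is not nilpotent. -/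
/-- The span of `X₂ = [[0,0,0],[-a,0,0],[0,a,0]]` and `X₃ = [[0,b,0],[0,0,b],[0,0,0]]`
consists of nilpotent matrices (every `α X₂ + β X₃` cubes to zero), but
`X₃ X₂ = diag(-ab, ab, 0)`, so for `ab ≠ 0` no power of `X₃ X₂` vanishes: the algebra
generated by `X₂, X₃` is not nilpotent. -/
theorem nilpotent_span_not_nilpotent_algebra (a b : ℝ) :
    (∀ α β : ℝ,
      (α • !![0, 0, 0; -a, 0, 0; 0, a, 0] + β • !![0, b, 0; 0, 0, b; 0, 0, 0]) ^ 3 = 0 ∧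
      IsNilpotent (α • !![0, 0, 0; -a, 0, 0; 0, a, 0] + β • !![0, b, 0; 0, 0, b; 0, 0, 0])) ∧
    (!![0, b, 0; 0, 0, b; 0, 0, 0] * !![(0 : ℝ), 0, 0; -a, 0, 0; 0, a, 0] =
      Matrix.diagonal ![-(a * b), a * b, 0]) ∧
    (a * b ≠ 0 → ∀ n : ℕ, 1 ≤ n →
      (!![0, b, 0; 0, 0, b; 0, 0, 0] * !![(0 : ℝ), 0, 0; -a, 0, 0; 0, a, 0]) ^ n ≠ 0) := by
  have cube_eq_zero (α β : ℝ) :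
      (α • !![0, 0, 0; -a, 0, 0; 0, a, 0] + β • !![0, b, 0; 0, 0, b; 0, 0, 0]) ^ 3 = 0 := by
    ext i j
    fin_cases i <;> fin_cases j <;>
      simp [pow_succ, Matrix.mul_apply, Fin.sum_univ_three, -mul_eq_zero] <;> ring
  have mul_eq_diagonal :
      !![0, b, 0; 0, 0, b; 0, 0, 0] * !![(0 : ℝ), 0, 0; -a, 0, 0; 0, a, 0] =
        Matrix.diagonal ![-(a * b), a * b, 0] := by
    ext i j
    fin_cases i <;> fin_cases j <;>
      simp [Matrix.mul_apply, Fin.sum_univ_three, mul_comm]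
  refine ⟨fun α β => ⟨cube_eq_zero α β, 3, cube_eq_zero α β⟩, mul_eq_diagonal, ?_⟩
  intro hab n _ hn
  rw [mul_eq_diagonal, Matrix.diagonal_pow] at hn
  have entry : (a * b) ^ n = 0 := by simpa using congrFun (congrFun hn 1) 1
  exact pow_ne_zero n hab entry
end
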